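/- For every reflection subgroup U of W, the orthogonal complement U° equals the pointwise stabilizer Z_W(Fix_V(U)^⊥) of the orthogonal complement of the fixed-point subspace of U. In particular, U° is a parabolic subgroup of W. -/

import Mathlib

open scoped RealInnerProductSpace

variable {V : Type*} [NormedAddCommGroup V] [InnerProductSpace ℝ V] [FiniteDimensional ℝ V]

/-- `r` is a reflection: there is a nonzero root `α` with `r α = -α` and `r` fixes
every vector orthogonal to `α`. -/
def IsReflection (r : V ≃ₗᵢ[ℝ] V) : Prop :=
  ∃ α : V, α ≠ 0 ∧ r α = -α ∧ ∀ v : V, ⟪α, v⟫ = 0 → r v = v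

/-- The pointwise stabilizer in `W` of a set `s ⊆ V`. -/
def pointwiseStabilizer (W : Subgroup (V ≃ₗᵢ[ℝ] V)) (s : Set V) : Subgroup (V ≃ₗᵢ[ℝ] V) where
  carrier := {w | w ∈ W ∧ ∀ v ∈ s, w v = v}
  one_mem' := ⟨W.one_mem, fun v _ => rfl⟩
  mul_mem' := fun {a b} ha hb => ⟨W.mul_mem ha.1 hb.1, fun v hv => by
    have h : (a * b) v = a (b v) := rfl
    rw [h, hb.2 v hv, ha.2 v hv]⟩
  inv_mem' := fun {a} ha => ⟨W.inv_mem ha.1, fun v hv => by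
    show a.symm v = v
    conv_lhs => rw [← ha.2 v hv]
    exact a.symm_apply_apply v⟩

/-- The fixed-point subspace of a subgroup `U` of the isometry group of `V`. -/
def fixedSubmodule (U : Subgroup (V ≃ₗᵢ[ℝ] V)) : Submodule ℝ V where
  carrier := {v | ∀ u ∈ U, u v = v}
  zero_mem' := fun u _ => map_zero u
  add_mem' := fun {a b} ha hb u hu => by rw [map_add, ha u hu, hb u hu]
  smul_mem' := fun c v hv u hu => by rw [map_smul, hv u hu]

/-- The set of reflections lying in `W`. -/
def reflectionsIn (W : Subgroup (V ≃ₗᵢ[ℝ] V)) : Set (V ≃ₗᵢ[ℝ] V) :=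
  {t | t ∈ W ∧ IsReflection t}

/-- The orthogonal complement `U°` of a subgroup `U` of `W`: the subgroup generated by the
reflections of `W` that commute with, and differ from, every reflection of `W` lying in `U`. -/
def orthogonalComplement (W U : Subgroup (V ≃ₗᵢ[ℝ] V)) : Subgroup (V ≃ₗᵢ[ℝ] V) :=
  Subgroup.closure {t | t ∈ reflectionsIn W ∧
    ∀ s ∈ reflectionsIn W, s ∈ U → t * s = s * t ∧ t ≠ s}

/-- The orthogonal reflection in the hyperplane perpendicular to `α`. -/
noncomputable def sRefl (α : V) : V ≃ₗᵢ[ℝ] V := (ℝ ∙ α)ᗮ.reflection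

theorem sRefl_apply {α : V} (h : ‖α‖ = 1) (x : V) : sRefl α x = x - (2 * ⟪α, x⟫) • α := by
  unfold sRefl
  rw [Submodule.reflection_orthogonal_apply, Submodule.reflection_singleton_apply]
  simp [h, mul_smul, two_smul]

theorem sRefl_self (α : V) : sRefl α α = -α :=
  Submodule.reflection_orthogonalComplement_singleton_eq_neg α

theorem sRefl_sRefl (α x : V) : sRefl α (sRefl α x) = x :=
  Submodule.reflection_reflection _ x

theorem sRefl_mul_self (α : V) : sRefl α * sRefl α = 1 := by
  ext x; exact sRefl_sRefl α x

theorem inner_sRefl (α x y : V) : ⟪sRefl α x, y⟫ = ⟪x, sRefl α y⟫ := by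
  have := (sRefl α).inner_map_map x (sRefl α y)
  rwa [sRefl_sRefl] at this

theorem sRefl_fix (α v : V) (h : ⟪α, v⟫ = 0) : sRefl α v = v :=
  Submodule.reflection_mem_subspace_eq_self (Submodule.mem_orthogonal_singleton_iff_inner_right.2 h)

theorem inner_self_one {α : V} (h : ‖α‖ = 1) : ⟪α, α⟫ = 1 := by
  rw [real_inner_self_eq_norm_sq, h]; norm_num

theorem isReflection_sRefl {α : V} (h : ‖α‖ = 1) : IsReflection (sRefl α) := by
  refine ⟨α, ?_, sRefl_self α, sRefl_fix α⟩
  rintro rfl; simp at h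

/-- A map negating `α` and fixing its orthogonal complement is determined. -/
theorem eq_sRefl {r : V ≃ₗᵢ[ℝ] V} {α : V} (h : ‖α‖ = 1) (h1 : r α = -α)
    (h2 : ∀ v : V, ⟪α, v⟫ = 0 → r v = v) : r = sRefl α := by
  ext x
  have hx : x = (x - ⟪α, x⟫ • α) + ⟪α, x⟫ • α := by abel
  have h3 : r (x - ⟪α, x⟫ • α) = x - ⟪α, x⟫ • α := by
    apply h2
    rw [inner_sub_right, inner_smul_right, inner_self_one h]; ring
  rw [sRefl_apply h]
  conv_lhs => rw [hx]
  rw [map_add, h3, map_smul, h1]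
  module

theorem exists_unit_root {r : V ≃ₗᵢ[ℝ] V} (hr : IsReflection r) :
    ∃ α : V, ‖α‖ = 1 ∧ r = sRefl α := by
  obtain ⟨α, h0, h1, h2⟩ := hr
  have hn : ‖(‖α‖⁻¹ : ℝ) • α‖ = 1 := by
    rw [norm_smul, norm_inv, norm_norm]
    exact inv_mul_cancel₀ (norm_ne_zero_iff.2 h0)
  refine ⟨(‖α‖⁻¹ : ℝ) • α, hn, eq_sRefl hn ?_ ?_⟩
  · rw [map_smul, h1, smul_neg]
  · intro v hv
    apply h2
    rw [real_inner_smul_left] at hv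
    rcases mul_eq_zero.1 hv with h | h
    · exact absurd (inv_eq_zero.1 h) (norm_ne_zero_iff.2 h0)
    · exact h

theorem sRefl_neg {α : V} (h : ‖α‖ = 1) : sRefl (-α) = sRefl α := by
  ext x
  rw [sRefl_apply h, sRefl_apply (by rwa [norm_neg])]
  simp

theorem sRefl_conj {α : V} (h : ‖α‖ = 1) (g : V ≃ₗᵢ[ℝ] V) : sRefl (g α) = g * sRefl α * g⁻¹ := by
  ext x
  have e : (g * sRefl α * g⁻¹) x = g (sRefl α (g.symm x)) := rfl
  have e2 : ⟪g α, x⟫ = ⟪α, g.symm x⟫ := by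
    rw [← g.inner_map_map α (g.symm x), g.apply_symm_apply]
  rw [e, sRefl_apply h, sRefl_apply (by rwa [g.norm_map]), e2, map_sub, map_smul,
    g.apply_symm_apply]

/-- If the reflection in `β` negates `α`, both of unit length, then `α = ±β`. -/
theorem eq_or_neg {α β : V} (ha : ‖α‖ = 1) (hb : ‖β‖ = 1) (h : sRefl β α = -α) :
    α = β ∨ α = -β := by
  rw [sRefl_apply hb] at h
  have h1 : α = ⟪β, α⟫ • β := by
    have h2 : (2 : ℝ) • α = (2 : ℝ) • (⟪β, α⟫ • β) := by
      rw [sub_eq_iff_eq_add] at h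
      rw [smul_smul, two_smul]
      nth_rewrite 1 [h]
      abel
    exact smul_right_injective V (two_ne_zero) h2
  have h3 : |⟪β, α⟫| = 1 := by
    have := congrArg norm h1
    rw [norm_smul, ha, hb, mul_one] at this
    exact this.symm
  rcases eq_or_eq_neg_of_abs_eq h3 with h4 | h4
  · left; rw [h4, one_smul] at h1; exact h1
  · right; rw [h4, neg_smul, one_smul] at h1; exact h1

/-- Unit roots of `W`. -/
def unitRoots (W : Subgroup (V ≃ₗᵢ[ℝ] V)) : Set V := {α | ‖α‖ = 1 ∧ sRefl α ∈ W}

theorem unitRoots_finite (W : Subgroup (V ≃ₗᵢ[ℝ] V))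
    (hWfin : (W : Set (V ≃ₗᵢ[ℝ] V)).Finite) : (unitRoots W).Finite := by
  have : unitRoots W ⊆ ⋃ w ∈ (W : Set (V ≃ₗᵢ[ℝ] V)), {α | ‖α‖ = 1 ∧ sRefl α = w} := by
    intro α hα
    simp only [Set.mem_iUnion]
    exact ⟨sRefl α, hα.2, hα.1, rfl⟩
  refine Set.Finite.subset (Set.Finite.biUnion hWfin fun w _ => ?_) this
  by_cases hne : ∃ β, ‖β‖ = 1 ∧ sRefl β = w
  · obtain ⟨β, hb, rfl⟩ := hne
    refine Set.Finite.subset (Set.toFinite {β, -β}) ?_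
    rintro α ⟨ha, h⟩
    exact eq_or_neg ha hb (by rw [← h, sRefl_self])
  · convert Set.finite_empty
    ext α
    simp only [Set.mem_ofPred_eq, Set.mem_empty_iff_false, iff_false]
    exact fun h => hne ⟨α, h⟩

theorem unitRoots_map {W : Subgroup (V ≃ₗᵢ[ℝ] V)} {α : V} (ha : α ∈ unitRoots W)
    {g : V ≃ₗᵢ[ℝ] V} (hg : g ∈ W) : g α ∈ unitRoots W := by
  refine ⟨by rw [g.norm_map]; exact ha.1, ?_⟩
  rw [sRefl_conj ha.1]
  exact W.mul_mem (W.mul_mem hg ha.2) (W.inv_mem hg)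

theorem unitRoots_neg {W : Subgroup (V ≃ₗᵢ[ℝ] V)} {α : V} (ha : α ∈ unitRoots W) :
    -α ∈ unitRoots W := by
  refine ⟨by rw [norm_neg]; exact ha.1, ?_⟩
  rw [sRefl_neg ha.1]; exact ha.2

theorem exists_regular (W : Subgroup (V ≃ₗᵢ[ℝ] V))
    (hWfin : (W : Set (V ≃ₗᵢ[ℝ] V)).Finite) : ∃ p : V, ∀ α ∈ unitRoots W, ⟪p, α⟫ ≠ 0 := by
  have := (unitRoots_finite W hWfin).to_subtype
  obtain ⟨p, hp⟩ := Module.Dual.exists_forall_ne_zero_of_forall_exists (K := ℝ) (M := V)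
    (fun i : unitRoots W => innerₛₗ ℝ (i : V)) (fun i => ⟨i, by
      have := inner_self_one i.2.1
      rw [innerₛₗ_apply_apply, this]
      exact one_ne_zero⟩)
  refine ⟨p, fun α hα h => hp ⟨α, hα⟩ ?_⟩
  rw [real_inner_comm] at h
  simpa using h

/-- Positive unit roots with respect to `p`. -/
def posRoots (W : Subgroup (V ≃ₗᵢ[ℝ] V)) (p : V) : Set V := {α | α ∈ unitRoots W ∧ 0 < ⟪p, α⟫}

/-- Simple unit roots with respect to `p`. -/
def simpRoots (W : Subgroup (V ≃ₗᵢ[ℝ] V)) (p : V) : Set V :=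
  {β | β ∈ posRoots W p ∧ ∀ α ∈ posRoots W p, α ≠ β → 0 < ⟪p, sRefl β α⟫}

theorem exists_simple_acute (W : Subgroup (V ≃ₗᵢ[ℝ] V))
    (hWfin : (W : Set (V ≃ₗᵢ[ℝ] V)).Finite) (p : V) (hp : ∀ α ∈ unitRoots W, ⟪p, α⟫ ≠ 0)
    (α : V) (hα : α ∈ posRoots W p) : ∃ β ∈ simpRoots W p, 0 < ⟪α, β⟫ := by
  have hfin : (posRoots W p).Finite := (unitRoots_finite W hWfin).subset fun _ h => h.1
  obtain ⟨γ, hγ, hmax⟩ := Set.exists_max_image (posRoots W p) (fun β => ⟪α, β⟫ / ⟪p, β⟫) hfin ⟨α, hα⟩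
  set m : ℝ := ⟪α, γ⟫ / ⟪p, γ⟫ with hm
  have hmpos : 0 < m := by
    have h1 := hmax α hα
    have h2 : 0 < ⟪α, α⟫ / ⟪p, α⟫ := by
      rw [inner_self_one hα.1.1]; exact div_pos one_pos hα.2
    exact lt_of_lt_of_le h2 h1
  have hle : ∀ β ∈ posRoots W p, ⟪α, β⟫ ≤ m * ⟪p, β⟫ := fun β hβ => by
    have := hmax β hβ
    exact (div_le_iff₀ hβ.2).1 this
  obtain ⟨β, hβ, hmin⟩ := Set.exists_min_image {β | β ∈ posRoots W p ∧ ⟪α, β⟫ = m * ⟪p, β⟫}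
    (fun β => ⟪p, β⟫) (hfin.subset fun _ h => h.1)
    ⟨γ, hγ, by rw [hm, div_mul_cancel₀ _ hγ.2.ne']⟩
  refine ⟨β, ⟨hβ.1, ?_⟩, ?_⟩
  · intro ρ hρ hne
    by_contra hneg
    have hr : sRefl β ρ ∈ unitRoots W := unitRoots_map hρ.1 hβ.1.1.2
    have hneg' : ⟪p, sRefl β ρ⟫ < 0 := lt_of_le_of_ne (not_lt.1 hneg) (hp _ hr)
    have hσ : -sRefl β ρ ∈ posRoots W p :=
      ⟨unitRoots_neg hr, by rw [inner_neg_right]; linarith⟩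
    have hform : ∀ x : V, ⟪x, sRefl β ρ⟫ = ⟪x, ρ⟫ - 2 * ⟪β, ρ⟫ * ⟪x, β⟫ := fun x => by
      rw [sRefl_apply hβ.1.1.1, inner_sub_right, inner_smul_right]
    have e1 := hle ρ hρ
    have e2 := hle _ hσ
    rw [inner_neg_right, inner_neg_right, hform, hform] at e2
    have e3 := hβ.2
    rw [e3] at e2
    have e4 : ⟪α, ρ⟫ = m * ⟪p, ρ⟫ := by nlinarith
    have e5 : ⟪α, -sRefl β ρ⟫ = m * ⟪p, -sRefl β ρ⟫ := by
      rw [inner_neg_right, inner_neg_right, hform, hform, e3, e4]; ring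
    have e6 := hmin ρ ⟨hρ, e4⟩
    have e7 := hmin _ ⟨hσ, e5⟩
    simp only [inner_neg_right, hform] at e7
    have e8 : ⟪β, ρ⟫ < 1 := by
      rw [inner_lt_one_iff_real_of_norm_eq_one hβ.1.1.1 hρ.1.1]
      exact fun h => hne h.symm
    have := hβ.1.2
    nlinarith
  · rw [hβ.2]; exact mul_pos hmpos hβ.1.2

theorem sRefl_mem_closure_simple (W : Subgroup (V ≃ₗᵢ[ℝ] V))
    (hWfin : (W : Set (V ≃ₗᵢ[ℝ] V)).Finite) (p : V) (hp : ∀ α ∈ unitRoots W, ⟪p, α⟫ ≠ 0)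
    (α : V) (hα : α ∈ posRoots W p) :
    sRefl α ∈ Subgroup.closure (sRefl '' simpRoots W p) := by
  have hfin : (posRoots W p).Finite := (unitRoots_finite W hWfin).subset fun _ h => h.1
  by_contra hcon
  obtain ⟨γ, hγ, hmin⟩ := Set.exists_min_image
    {γ | γ ∈ posRoots W p ∧ sRefl γ ∉ Subgroup.closure (sRefl '' simpRoots W p)}
    (fun β => ⟪p, β⟫) (hfin.subset fun _ h => h.1) ⟨α, hα, hcon⟩
  obtain ⟨β, hβ, hpos⟩ := exists_simple_acute W hWfin p hp γ hγ.1
  have hβc : sRefl β ∈ Subgroup.closure (sRefl '' simpRoots W p) :=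
    Subgroup.subset_closure ⟨β, hβ, rfl⟩
  by_cases hne : γ = β
  · exact hγ.2 (hne ▸ hβc)
  have hr : sRefl β γ ∈ posRoots W p :=
    ⟨unitRoots_map hγ.1.1 hβ.1.1.2, hβ.2 γ hγ.1 hne⟩
  have hnot : sRefl (sRefl β γ) ∉ Subgroup.closure (sRefl '' simpRoots W p) := by
    intro h
    rw [sRefl_conj hγ.1.1.1] at h
    rw [Subgroup.mul_mem_cancel_right _ (Subgroup.inv_mem _ hβc),
      Subgroup.mul_mem_cancel_left _ hβc] at h
    exact hγ.2 h
  have := hmin _ ⟨hr, hnot⟩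
  simp only [sRefl_apply hβ.1.1.1, inner_sub_right, inner_smul_right] at this
  rw [real_inner_comm] at hpos
  have := mul_pos hpos hβ.1.2
  linarith

/-- Words in simple reflections. -/
noncomputable def wordProd (l : List V) : V ≃ₗᵢ[ℝ] V := (l.map sRefl).prod

theorem wordProd_cons (β : V) (l : List V) : wordProd (β :: l) = sRefl β * wordProd l := by
  simp [wordProd]

theorem exists_word (W : Subgroup (V ≃ₗᵢ[ℝ] V))
    (hWfin : (W : Set (V ≃ₗᵢ[ℝ] V)).Finite)
    (hWgen : W = Subgroup.closure {r : V ≃ₗᵢ[ℝ] V | r ∈ W ∧ IsReflection r})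
    (p : V) (hp : ∀ α ∈ unitRoots W, ⟪p, α⟫ ≠ 0) (w : V ≃ₗᵢ[ℝ] V) (hw : w ∈ W) :
    ∃ l : List V, (∀ β ∈ l, β ∈ simpRoots W p) ∧ wordProd l = w := by
  have hle : W ≤ Subgroup.closure (sRefl '' simpRoots W p) := by
    conv_lhs => rw [hWgen]
    rw [Subgroup.closure_le]
    rintro r ⟨hr, hrr⟩
    obtain ⟨α, ha, rfl⟩ := exists_unit_root hrr
    have hα : α ∈ unitRoots W := ⟨ha, hr⟩
    rcases lt_or_gt_of_ne (hp α hα) with h | h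
    · have := sRefl_mem_closure_simple W hWfin p hp (-α)
        ⟨unitRoots_neg hα, by rw [inner_neg_right]; linarith⟩
      rwa [sRefl_neg ha] at this
    · exact sRefl_mem_closure_simple W hWfin p hp α ⟨hα, h⟩
  have hw' := hle hw
  clear hw
  induction hw' using Subgroup.closure_induction_left with
  | one => exact ⟨[], by simp, by simp [wordProd]⟩
  | mul_left x hx y hy ih =>
    obtain ⟨β, hβ, rfl⟩ := hx
    obtain ⟨l, hl, rfl⟩ := ih
    exact ⟨β :: l, by simpa using ⟨hβ, hl⟩, wordProd_cons β l⟩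
  | inv_mul_cancel x hx y hy ih =>
    obtain ⟨β, hβ, rfl⟩ := hx
    obtain ⟨l, hl, rfl⟩ := ih
    refine ⟨β :: l, by simpa using ⟨hβ, hl⟩, ?_⟩
    rw [wordProd_cons, ← eq_inv_of_mul_eq_one_left (sRefl_mul_self β)]

theorem exchange (W : Subgroup (V ≃ₗᵢ[ℝ] V)) (p : V) (l : List V)
    (hl : ∀ β ∈ l, β ∈ simpRoots W p) (α : V) (hα : α ∈ posRoots W p)
    (hneg : ⟪wordProd l p, α⟫ < 0) :
    ∃ l' : List V, (∀ β ∈ l', β ∈ simpRoots W p) ∧ l'.length + 1 = l.length ∧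
      sRefl α * wordProd l = wordProd l' := by
  induction l generalizing α with
  | nil =>
    have : wordProd ([] : List V) p = p := by simp [wordProd]
    rw [this] at hneg
    exact absurd hα.2 (not_lt.2 hneg.le)
  | cons β l ih =>
    have hβ : β ∈ simpRoots W p := hl β (by simp)
    have hl' : ∀ β ∈ l, β ∈ simpRoots W p := fun γ h => hl γ (by simp [h])
    by_cases hne : α = β
    · refine ⟨l, hl', by simp, ?_⟩
      rw [hne, wordProd_cons, ← mul_assoc, sRefl_mul_self, one_mul]
    · have hr : sRefl β α ∈ posRoots W p :=
        ⟨unitRoots_map hα.1 hβ.1.1.2, hβ.2 α hα hne⟩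
      have hn : ⟪wordProd l p, sRefl β α⟫ < 0 := by
        rw [← inner_sRefl]
        rw [wordProd_cons] at hneg
        exact hneg
      obtain ⟨l', h1, h2, h3⟩ := ih hl' _ hr hn
      refine ⟨β :: l', ?_, by simp [h2], ?_⟩
      · intro γ hγ
        rcases List.mem_cons.1 hγ with rfl | h
        · exact hβ
        · exact h1 γ h
      · rw [wordProd_cons, wordProd_cons, ← h3, sRefl_conj hα.1.1,
          ← eq_inv_of_mul_eq_one_left (sRefl_mul_self β)]
        simp only [← mul_assoc]
        rw [sRefl_mul_self, one_mul]

theorem steinberg_aux (W : Subgroup (V ≃ₗᵢ[ℝ] V)) (p v : V)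
    (hp : ∀ α ∈ unitRoots W, ⟪p, α⟫ ≠ 0) (hv : ∀ α ∈ posRoots W p, 0 ≤ ⟪v, α⟫)
    (n : ℕ) : ∀ l : List V, l.length ≤ n → (∀ β ∈ l, β ∈ simpRoots W p) → wordProd l v = v →
      wordProd l ∈ W ∧
      wordProd l ∈ Subgroup.closure {t : V ≃ₗᵢ[ℝ] V | (t ∈ W ∧ t v = v) ∧ IsReflection t} := by
  induction n with
  | zero =>
    intro l hl _ _
    have : l = [] := List.length_eq_zero_iff.1 (by omega)
    subst this
    simp only [wordProd, List.map_nil, List.prod_nil]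
    exact ⟨one_mem _, one_mem _⟩
  | succ n ih =>
    intro l hlen hl hfix
    cases l with
    | nil =>
      simp only [wordProd, List.map_nil, List.prod_nil]
      exact ⟨one_mem _, one_mem _⟩
    | cons β l =>
      have hβ : β ∈ simpRoots W p := hl β (by simp)
      have hl' : ∀ β ∈ l, β ∈ simpRoots W p := fun γ h => hl γ (by simp [h])
      simp only [List.length_cons] at hlen
      have hW : ∀ l : List V, (∀ β ∈ l, β ∈ simpRoots W p) → wordProd l ∈ W := by
        intro l hl
        refine list_prod_mem ?_
        intro x hx
        obtain ⟨γ, hγ, rfl⟩ := List.mem_map.1 hx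
        exact (hl γ hγ).1.1.2
      have key : ∀ g ∈ W, ∀ ρ ∈ unitRoots W, ∀ x, ⟪g x, ρ⟫ = ⟪x, g⁻¹ ρ⟫ := by
        intro g _ ρ _ x
        have : g (g⁻¹ ρ) = ρ := g.apply_symm_apply ρ
        rw [← g.inner_map_map x (g⁻¹ ρ), this]
      have hu := hW l hl'
      have hreg : ⟪wordProd l p, β⟫ ≠ 0 := by
        rw [key _ hu _ hβ.1.1]
        exact hp _ (unitRoots_map hβ.1.1 (W.inv_mem hu))
      rcases lt_or_gt_of_ne hreg with h | h
      · obtain ⟨l', h1, h2, h3⟩ := exchange W p l hl' β hβ.1 h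
        rw [wordProd_cons] at hfix ⊢
        rw [h3] at hfix ⊢
        exact ih l' (by omega) h1 hfix
      · have hu' := hW _ hl
        set u := wordProd (β :: l) with hudef
        have hroot : u⁻¹ β ∈ unitRoots W := unitRoots_map hβ.1.1 (W.inv_mem hu')
        have h1 : ⟪u p, β⟫ < 0 := by
          have e : u p = sRefl β (wordProd l p) := by rw [hudef, wordProd_cons]; rfl
          rw [e, inner_sRefl, sRefl_self, inner_neg_right]; linarith
        rw [key _ hu' _ hβ.1.1] at h1
        have h2 := hv (-(u⁻¹ β)) ⟨unitRoots_neg hroot, by rw [inner_neg_right]; linarith⟩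
        rw [inner_neg_right, ← key _ hu' _ hβ.1.1, hfix] at h2
        have h3 := hv β hβ.1
        have h4 : ⟪β, v⟫ = 0 := by rw [real_inner_comm]; linarith
        have h5 : sRefl β v = v := sRefl_fix β v h4
        have h6 : wordProd l v = v := by
          have e : u v = sRefl β (wordProd l v) := by rw [hudef, wordProd_cons]; rfl
          rw [hfix] at e
          rw [← sRefl_sRefl β (wordProd l v), ← e, h5]
        refine ⟨hu', ?_⟩
        rw [hudef, wordProd_cons]
        exact mul_mem (Subgroup.subset_closure ⟨⟨hβ.1.1.2, h5⟩, isReflection_sRefl hβ.1.1.1⟩)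
          (ih l (by omega) hl' h6).2

theorem steinberg_one (W : Subgroup (V ≃ₗᵢ[ℝ] V))
    (hWfin : (W : Set (V ≃ₗᵢ[ℝ] V)).Finite)
    (hWgen : W = Subgroup.closure {r : V ≃ₗᵢ[ℝ] V | r ∈ W ∧ IsReflection r})
    (v : V) (w : V ≃ₗᵢ[ℝ] V) (hw : w ∈ W) (hwv : w v = v) :
    w ∈ Subgroup.closure {t : V ≃ₗᵢ[ℝ] V | (t ∈ W ∧ t v = v) ∧ IsReflection t} := by
  obtain ⟨p₀, hp₀⟩ := exists_regular W hWfin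
  obtain ⟨g, hg, hmax⟩ := Set.exists_max_image (W : Set (V ≃ₗᵢ[ℝ] V)) (fun g => ⟪g p₀, v⟫) hWfin
    ⟨1, W.one_mem⟩
  have hp : ∀ α ∈ unitRoots W, ⟪g p₀, α⟫ ≠ 0 := by
    intro α hα
    have e : g (g⁻¹ α) = α := g.apply_symm_apply α
    rw [← e, g.inner_map_map]
    exact hp₀ _ (unitRoots_map hα (W.inv_mem hg))
  have hv : ∀ α ∈ posRoots W (g p₀), 0 ≤ ⟪v, α⟫ := by
    intro α hα
    have h := hmax (sRefl α * g) (W.mul_mem hα.1.2 hg)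
    have e : (sRefl α * g) p₀ = sRefl α (g p₀) := rfl
    simp only [e, sRefl_apply hα.1.1, inner_sub_left, real_inner_smul_left] at h
    rw [real_inner_comm (g p₀) α] at h
    rw [real_inner_comm]
    by_contra hc
    push Not at hc
    have := mul_neg_of_neg_of_pos hc hα.2
    linarith
  obtain ⟨l, hl, rfl⟩ := exists_word W hWfin hWgen (g p₀) hp w hw
  exact (steinberg_aux W (g p₀) v hp hv l.length l le_rfl hl hwv).2

theorem steinberg_finset (W : Subgroup (V ≃ₗᵢ[ℝ] V))
    (hWfin : (W : Set (V ≃ₗᵢ[ℝ] V)).Finite)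
    (hWgen : W = Subgroup.closure {r : V ≃ₗᵢ[ℝ] V | r ∈ W ∧ IsReflection r})
    (b : Finset V) : pointwiseStabilizer W (b : Set V) =
      Subgroup.closure {t | t ∈ pointwiseStabilizer W (b : Set V) ∧ IsReflection t} := by
  classical
  induction b using Finset.induction_on with
  | empty =>
    have : pointwiseStabilizer W ((∅ : Finset V) : Set V) = W := by
      ext w
      exact ⟨fun h => h.1, fun h => ⟨h, by simp⟩⟩
    rw [this]; exact hWgen
  | insert a b ha ih =>
    refine le_antisymm ?_ ((Subgroup.closure_le _).2 fun t ht => ht.1)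
    intro w hw
    have hfin : (pointwiseStabilizer W (b : Set V) : Set (V ≃ₗᵢ[ℝ] V)).Finite :=
      hWfin.subset fun w h => h.1
    have h := steinberg_one _ hfin ih a w ⟨hw.1, fun v hv => hw.2 v (by simp at hv ⊢; tauto)⟩
      (hw.2 a (by simp))
    refine Subgroup.closure_mono ?_ h
    rintro t ⟨⟨ht, hta⟩, htr⟩
    refine ⟨⟨ht.1, fun v hv => ?_⟩, htr⟩
    rcases Finset.mem_insert.1 (Finset.mem_coe.1 hv) with rfl | h
    · exact hta
    · exact ht.2 v h

theorem steinberg (W : Subgroup (V ≃ₗᵢ[ℝ] V))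
    (hWfin : (W : Set (V ≃ₗᵢ[ℝ] V)).Finite)
    (hWgen : W = Subgroup.closure {r : V ≃ₗᵢ[ℝ] V | r ∈ W ∧ IsReflection r})
    (X : Submodule ℝ V) : pointwiseStabilizer W (X : Set V) =
      Subgroup.closure {t | t ∈ pointwiseStabilizer W (X : Set V) ∧ IsReflection t} := by
  obtain ⟨b, hb⟩ := IsNoetherian.noetherian X
  have : pointwiseStabilizer W (X : Set V) = pointwiseStabilizer W (b : Set V) := by
    ext w
    refine ⟨fun h => ⟨h.1, fun v hv => h.2 v (hb ▸ Submodule.subset_span hv)⟩,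
      fun h => ⟨h.1, fun v hv => ?_⟩⟩
    rw [← hb] at hv
    induction hv using Submodule.span_induction with
    | mem x hx => exact h.2 x hx
    | zero => exact map_zero w
    | add x y _ _ hx hy => rw [map_add, hx, hy]
    | smul c x _ hx => rw [map_smul, hx]
  rw [this]
  exact steinberg_finset W hWfin hWgen b

/-- For every reflection subgroup `U` of `W`, the orthogonal complement `U°` equals the
pointwise stabilizer of `Fix_V(U)ᗮ`; in particular `U°` is a parabolic subgroup of `W`. -/
theorem orthogonalComplement_eq_pointwiseStabilizer
    (W : Subgroup (V ≃ₗᵢ[ℝ] V))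
    (hWfin : (W : Set (V ≃ₗᵢ[ℝ] V)).Finite)
    (hWgen : W = Subgroup.closure {r : V ≃ₗᵢ[ℝ] V | r ∈ W ∧ IsReflection r})
    (U : Subgroup (V ≃ₗᵢ[ℝ] V)) (hUW : U ≤ W)
    (hUgen : U = Subgroup.closure {t : V ≃ₗᵢ[ℝ] V | t ∈ U ∧ IsReflection t}) :
    orthogonalComplement W U
        = pointwiseStabilizer W (((fixedSubmodule U)ᗮ : Submodule ℝ V) : Set V) ∧
      ∃ X : Submodule ℝ V, orthogonalComplement W U = pointwiseStabilizer W (X : Set V) := by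
  have main : orthogonalComplement W U
        = pointwiseStabilizer W (((fixedSubmodule U)ᗮ : Submodule ℝ V) : Set V) := by
    rw [steinberg W hWfin hWgen, orthogonalComplement]
    congr 1
    ext t
    constructor
    · rintro ⟨⟨htW, htr⟩, hcomm⟩
      refine ⟨⟨htW, ?_⟩, htr⟩
      obtain ⟨α, ha, rfl⟩ := exists_unit_root htr
      have hαfix : α ∈ fixedSubmodule U := by
        have hle : U ≤ pointwiseStabilizer U {α} := by
          conv_lhs => rw [hUgen]
          rw [Subgroup.closure_le]
          rintro s ⟨hsU, hsr⟩
          obtain ⟨h1, h2⟩ := hcomm s ⟨hUW hsU, hsr⟩ hsU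
          obtain ⟨β, hb, rfl⟩ := exists_unit_root hsr
          refine ⟨hsU, ?_⟩
          intro x hx
          rw [Set.mem_singleton_iff.1 hx]
          have e : sRefl α (sRefl β α) = -sRefl β α := by
            have := congrArg (fun g : V ≃ₗᵢ[ℝ] V => g α) h1
            change sRefl α (sRefl β α) = sRefl β (sRefl α α) at this
            rw [this, sRefl_self, map_neg]
          rcases eq_or_neg (by rw [LinearIsometryEquiv.norm_map]; exact ha) ha e with h | h
          · exact h
          · exfalso
            rcases eq_or_neg ha hb h with rfl | rfl
            · exact h2 rfl
            · exact h2 (sRefl_neg hb)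
        intro u hu
        exact (hle hu).2 α rfl
      intro v hv
      exact sRefl_fix α v (hv α hαfix)
    · rintro ⟨⟨htW, hfix⟩, htr⟩
      refine ⟨⟨htW, htr⟩, ?_⟩
      rintro s ⟨hsW, hsr⟩ hsU
      obtain ⟨β, hb, rfl⟩ := exists_unit_root hsr
      have hβ : t β = β := by
        apply hfix
        intro v hv
        have h1 := hv _ hsU
        have h2 := inner_sRefl β v β
        rw [h1, sRefl_self, inner_neg_right] at h2
        linarith
      constructor
      · have h := sRefl_conj hb t
        rw [hβ] at h
        conv_rhs => rw [h]
        group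
      · rintro rfl
        rw [sRefl_self] at hβ
        have h1 := inner_self_one hb
        have h2 := congrArg (fun x => ⟪β, x⟫) hβ
        simp only [inner_neg_right] at h2
        linarith
  exact ⟨main, _, main⟩
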